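/- Let φ ≥ 26 and let n ≥ 2 be even. There exist probability distributions on [0,1] for the edge weights of the complete bipartite graph K_{n,n}, each with probability density bounded from above by φ (namely, partitioning the nodes into n/2 groups {u_1^j, u_2^j, v_1^j, v_2^j}, the weights are independent with w^j_{11} uniform on [1−1/φ, 1], w^j_{12} and w^j_{21} uniform on (23/26, 23/26+1/φ], w^j_{22} uniform on [20/26−1/φ, 20/26+3/φ], and every edge between different groups uniform on [0, 1/φ]), and constants c > 0 and C > 0, such that for every t ≥ nφ/c, the probability that the belief propagation algorithm of Bayati et al. needs at least t iterations to converge is at least C·nφ/t. -/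

import Mathlib

open MeasureTheory

/-- The messages of the belief propagation algorithm of Bayati et al. on the complete
bipartite graph `K_{n,n}` with weights `w`. `(BPmsg n w t).1 i j r` is the message
`m⃗ᵗ_{ij}(r)` from `u_i` to `v_j` and `(BPmsg n w t).2 j i r` is the message
`m⃖ᵗ_{ji}(r)` from `v_j` to `u_i` at iteration `t`. (For `n ≤ 1` the maxima over the
empty index set take the junk value `0` of real suprema.) -/
noncomputable def BPmsg (n : ℕ) (w : Fin n → Fin n → ℝ) :
    ℕ → (Fin n → Fin n → Fin n → ℝ) × (Fin n → Fin n → Fin n → ℝ)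
  | 0 =>
    (fun i j r => if r = i then w i j else 0,
     fun j i r => if r = j then w i j else 0)
  | t + 1 =>
    (fun i j r =>
      if r = i then w i j + ∑ k ∈ Finset.univ.filter (· ≠ j), (BPmsg n w t).2 k i j
      else ⨆ q : {q : Fin n // q ≠ j},
        (w i q + ∑ k ∈ Finset.univ.filter (· ≠ j), (BPmsg n w t).2 k i (q : Fin n)),
     fun j i r =>
      if r = j then w i j + ∑ k ∈ Finset.univ.filter (· ≠ i), (BPmsg n w t).1 k j i
      else ⨆ q : {q : Fin n // q ≠ i},
        (w q j + ∑ k ∈ Finset.univ.filter (· ≠ i), (BPmsg n w t).1 k j (q : Fin n)))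

/-- The belief `bᵗ_{u_i}(r)` of node `u_i` at iteration `t`. -/
noncomputable def belief (n : ℕ) (w : Fin n → Fin n → ℝ) (t : ℕ) (i r : Fin n) : ℝ :=
  w i r + ∑ k, (BPmsg n w t).2 k i r

/-- A matching of `K_{n,n}`, given as a set of edges `(i, j)` (meaning `(u_i, v_j)`)
that are pairwise non-adjacent. -/
def IsMatching (n : ℕ) (M : Finset (Fin n × Fin n)) : Prop :=
  ∀ p ∈ M, ∀ q ∈ M, p ≠ q → p.1 ≠ q.1 ∧ p.2 ≠ q.2

/-- The weight of a matching of `K_{n,n}`. -/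
noncomputable def matchingWeight (n : ℕ) (w : Fin n → Fin n → ℝ)
    (M : Finset (Fin n × Fin n)) : ℝ :=
  ∑ p ∈ M, w p.1 p.2

/-- Belief propagation has converged by iteration `t`: there is a unique maximum-weight
matching `M`, and at every iteration `s ≥ t` the estimated matching (matching each `u_i`
to the unique maximizer of its belief) equals `M`. -/
def BPConvergedBy (n : ℕ) (w : Fin n → Fin n → ℝ) (t : ℕ) : Prop :=
  ∃ M : Finset (Fin n × Fin n), IsMatching n M ∧
    (∀ M', IsMatching n M' → M' ≠ M → matchingWeight n w M' < matchingWeight n w M) ∧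
    ∀ s, t ≤ s → ∀ i : Fin n, ∃ j : Fin n, (i, j) ∈ M ∧
      ∀ r : Fin n, r ≠ j → belief n w s i r < belief n w s i j

/-- The uniform distribution on the interval `[a, b]`. -/
noncomputable def unifIcc (a b : ℝ) : Measure ℝ :=
  (ENNReal.ofReal (b - a))⁻¹ • (volume : Measure ℝ).restrict (Set.Icc a b)

/-- The uniform distribution on the interval `(a, b]`. -/
noncomputable def unifIoc (a b : ℝ) : Measure ℝ :=
  (ENNReal.ofReal (b - a))⁻¹ • (volume : Measure ℝ).restrict (Set.Ioc a b)

/-- The smoothed weight distributions on `K_{n,n}` (for `n` even): the nodes are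
partitioned into `n/2` groups `{u_1^j, u_2^j, v_1^j, v_2^j}` (here
`u_p^j = u_{2j+p-1}` and `v_q^j = v_{2j+q-1}`), and within group `j` the weights are
`w^j_{11} ~ U[1-1/φ, 1]`, `w^j_{12}, w^j_{21} ~ U(23/26, 23/26+1/φ]`,
`w^j_{22} ~ U[20/26-1/φ, 20/26+3/φ]`, while the weight of every (light) edge between
different groups is `U[0, 1/φ]`. -/
noncomputable def smoothedMarginal (n : ℕ) (φ : ℝ) (p : Fin n × Fin n) : Measure ℝ :=
  if p.1.val / 2 = p.2.val / 2 then
    if p.1.val % 2 = 0 then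
      if p.2.val % 2 = 0 then unifIcc (1 - 1 / φ) 1
      else unifIoc (23 / 26) (23 / 26 + 1 / φ)
    else
      if p.2.val % 2 = 0 then unifIoc (23 / 26) (23 / 26 + 1 / φ)
      else unifIcc (20 / 26 - 1 / φ) (20 / 26 + 3 / φ)
  else unifIcc 0 (1 / φ)

/-- Reduced messages of belief propagation. -/
noncomputable def YAB (n : ℕ) (w : Fin n → Fin n → ℝ) :
    ℕ → (Fin n → Fin n → ℝ) × (Fin n → Fin n → ℝ)
  | 0 => (fun i j => w i j, fun j i => w i j)
  | t + 1 =>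
    (fun i j => w i j - ⨆ q : {q : Fin n // q ≠ j}, (YAB n w t).2 q i,
     fun j i => w i j - ⨆ q : {q : Fin n // q ≠ i}, (YAB n w t).1 q j)

lemma exists_sub (n : ℕ) (hn : 2 ≤ n) (j : Fin n) : Nonempty {q : Fin n // q ≠ j} := by
  have : Nontrivial (Fin n) := Fin.nontrivial_iff_two_le.mpr hn
  obtain ⟨q, hq⟩ := exists_ne j
  exact ⟨⟨q, hq⟩⟩

lemma aux_sum (n : ℕ) (c : Fin n → ℝ) (f : Fin n → ℝ) (j q : Fin n) :
    ∑ k ∈ Finset.univ.filter (· ≠ j), (c k + if q = k then f k else 0)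
      = ∑ k ∈ Finset.univ.filter (· ≠ j), c k + if q = j then 0 else f q := by
  rw [Finset.sum_add_distrib, Finset.sum_ite_eq]
  by_cases h : q = j <;> simp [h]

lemma aux_sup {ι : Type*} [Finite ι] [Nonempty ι] (S : ℝ) (f : ι → ℝ) :
    (⨆ q, (S + 2 * f q)) = S + 2 * ⨆ q, f q := by
  rw [Real.mul_iSup_of_nonneg (by norm_num), add_ciSup]
  exact (Set.finite_range _).bddAbove

/-- Structure of the messages. -/
lemma msg_struct (n : ℕ) (hn : 2 ≤ n) (w : Fin n → Fin n → ℝ) (t : ℕ) :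
    (∃ c : Fin n → Fin n → ℝ, ∀ i j r, (BPmsg n w t).1 i j r
        = c i j + if r = i then 2 * (YAB n w t).1 i j - w i j else 0) ∧
    (∃ c : Fin n → Fin n → ℝ, ∀ j i r, (BPmsg n w t).2 j i r
        = c j i + if r = j then 2 * (YAB n w t).2 j i - w i j else 0) := by
  induction t with
  | zero =>
    refine ⟨⟨fun _ _ => 0, ?_⟩, ⟨fun _ _ => 0, ?_⟩⟩ <;> intro i j r <;>
      simp only [BPmsg, YAB] <;> split_ifs <;> ring
  | succ t ih =>
    obtain ⟨⟨c, hc⟩, ⟨d, hd⟩⟩ := ih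
    constructor
    · refine ⟨fun i j => ∑ k ∈ Finset.univ.filter (· ≠ j), d k i +
        2 * ⨆ q : {q : Fin n // q ≠ j}, (YAB n w t).2 q i, ?_⟩
      intro i j r
      have := exists_sub n hn j
      simp only [BPmsg, YAB, hd, aux_sum n (fun k => d k i)
        (fun k => 2 * (YAB n w t).2 k i - w i k) j]
      split_ifs with h
      · ring
      · rw [add_zero, ← aux_sup]
        congr 1
        funext q
        rw [if_neg q.2]; ring
    · refine ⟨fun j i => ∑ k ∈ Finset.univ.filter (· ≠ i), c k j +
        2 * ⨆ q : {q : Fin n // q ≠ i}, (YAB n w t).1 q j, ?_⟩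
      intro j i r
      have := exists_sub n hn i
      simp only [BPmsg, YAB, hc, aux_sum n (fun k => c k j)
        (fun k => 2 * (YAB n w t).1 k j - w k j) i]
      split_ifs with h
      · ring
      · rw [add_zero, ← aux_sup]
        congr 1
        funext q
        rw [if_neg q.2]; ring

lemma belief_lt_iff (n : ℕ) (hn : 2 ≤ n) (w : Fin n → Fin n → ℝ) (t : ℕ) (i r s : Fin n) :
    belief n w t i r < belief n w t i s ↔ (YAB n w t).2 r i < (YAB n w t).2 s i := by
  obtain ⟨d, hd⟩ := (msg_struct n hn w t).2
  simp only [belief, hd, Finset.sum_add_distrib, Finset.sum_ite_eq, Finset.mem_univ, if_true]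
  constructor <;> intro h <;> linarith

/-- The properties of the reduced messages that are used. -/
structure BPsys (n : ℕ) (w : Fin n → Fin n → ℝ) (A B : ℕ → Fin n → Fin n → ℝ) : Prop where
  a0 : ∀ i j, A 0 i j = w i j
  b0 : ∀ j i, B 0 j i = w i j
  ale : ∀ t i j q, q ≠ j → A (t + 1) i j ≤ w i j - B t q i
  age : ∀ t i j c, (∀ q, q ≠ j → B t q i ≤ c) → w i j - c ≤ A (t + 1) i j
  ble : ∀ t j i q, q ≠ i → B (t + 1) j i ≤ w i j - A t q j
  bge : ∀ t j i c, (∀ q, q ≠ i → A t q j ≤ c) → w i j - c ≤ B (t + 1) j i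

lemma BPsys_YAB (n : ℕ) (hn : 2 ≤ n) (w : Fin n → Fin n → ℝ) :
    BPsys n w (fun t => (YAB n w t).1) (fun t => (YAB n w t).2) := by
  refine ⟨fun i j => rfl, fun i j => rfl, ?_, ?_, ?_, ?_⟩
  · intro t i j q hq
    have := le_ciSup (f := fun q : {q : Fin n // q ≠ j} => (YAB n w t).2 q i)
      (Set.finite_range _).bddAbove ⟨q, hq⟩
    simp only [YAB] at this ⊢
    linarith
  · intro t i j c h
    have := exists_sub n hn j
    have := ciSup_le (f := fun q : {q : Fin n // q ≠ j} => (YAB n w t).2 q i)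
      (fun q => h q q.2)
    simp only [YAB] at this ⊢
    linarith
  · intro t j i q hq
    have := le_ciSup (f := fun q : {q : Fin n // q ≠ i} => (YAB n w t).1 q j)
      (Set.finite_range _).bddAbove ⟨q, hq⟩
    simp only [YAB] at this ⊢
    linarith
  · intro t j i c h
    have := exists_sub n hn i
    have := ciSup_le (f := fun q : {q : Fin n // q ≠ i} => (YAB n w t).1 q j)
      (fun q => h q q.2)
    simp only [YAB] at this ⊢
    linarith

lemma BPsys.symm {n : ℕ} {w : Fin n → Fin n → ℝ} {A B : ℕ → Fin n → Fin n → ℝ}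
    (h : BPsys n w A B) : BPsys n (fun i j => w j i) B A :=
  ⟨h.b0, h.a0, h.ble, h.bge, h.ale, h.age⟩

/-- The weights lie in the ranges of the smoothed instance. -/
structure Good (n : ℕ) (σ : Fin n → Fin n) (e : Fin n → Prop) (w : Fin n → Fin n → ℝ) :
    Prop where
  inv : ∀ i, σ (σ i) = i
  ne : ∀ i, σ i ≠ i
  ev : ∀ i, e i ∨ e (σ i)
  l11 : ∀ i, e i → 25 / 26 ≤ w i i
  u11 : ∀ i, e i → w i i ≤ 1
  l22 : ∀ i, e i → 19 / 26 ≤ w (σ i) (σ i)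
  u22 : ∀ i, e i → w (σ i) (σ i) ≤ 23 / 26
  l12 : ∀ i, 23 / 26 ≤ w i (σ i)
  u12 : ∀ i, w i (σ i) ≤ 24 / 26
  light : ∀ i j, j ≠ i → j ≠ σ i → w i j ≤ 1 / 26

lemma Good.symm {n : ℕ} {σ : Fin n → Fin n} {e : Fin n → Prop} {w : Fin n → Fin n → ℝ}
    (h : Good n σ e w) : Good n σ e (fun i j => w j i) := by
  refine ⟨h.inv, h.ne, h.ev, h.l11, h.u11, h.l22, h.u22, ?_, ?_, ?_⟩
  · intro i; have := h.l12 (σ i); rwa [h.inv] at this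
  · intro i; have := h.u12 (σ i); rwa [h.inv] at this
  · intro i j h1 h2
    refine h.light j i h1.symm ?_
    rintro rfl
    exact h2 (h.inv j).symm

def LowE (n : ℕ) (σ : Fin n → Fin n) (e : Fin n → Prop) (w : Fin n → Fin n → ℝ)
    (A : Fin n → Fin n → ℝ) : Prop :=
  ∀ i, e i →
    (w i (σ i) + w (σ i) i ≤ w i i + w (σ i) (σ i) →
      w i i + w (σ i) (σ i) - w i (σ i) ≤ A i i ∧ w (σ i) (σ i) ≤ A (σ i) (σ i)) ∧
    (w i i + w (σ i) (σ i) ≤ w i (σ i) + w (σ i) i →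
      w i (σ i) + w (σ i) i - w i i ≤ A i (σ i) ∧ w (σ i) i ≤ A (σ i) i)

def LowO (n : ℕ) (σ : Fin n → Fin n) (e : Fin n → Prop) (w : Fin n → Fin n → ℝ)
    (A : Fin n → Fin n → ℝ) : Prop :=
  ∀ i, e i →
    (w i (σ i) + w (σ i) i ≤ w i i + w (σ i) (σ i) →
      0 ≤ A i i ∧ w i (σ i) - w i i ≤ A (σ i) (σ i)) ∧
    (w i i + w (σ i) (σ i) ≤ w i (σ i) + w (σ i) i →
      w i (σ i) - w i i ≤ A i (σ i) ∧ 0 ≤ A (σ i) i)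

def LightLe (n : ℕ) (σ : Fin n → Fin n) (B : Fin n → Fin n → ℝ) (l : ℝ) : Prop :=
  ∀ i q, q ≠ i → q ≠ σ i → B q i ≤ l

section det
variable {n : ℕ} {σ : Fin n → Fin n} {e : Fin n → Prop} {w : Fin n → Fin n → ℝ}
  {A B : ℕ → Fin n → Fin n → ℝ}

lemma Good.l21 (h : Good n σ e w) (i : Fin n) : 23 / 26 ≤ w (σ i) i := h.symm.l12 i
lemma Good.u21 (h : Good n σ e w) (i : Fin n) : w (σ i) i ≤ 24 / 26 := h.symm.u12 i

lemma LowE.low (h : Good n σ e w) {a : Fin n → Fin n → ℝ} (H : LowE n σ e w a) (q : Fin n) :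
    ∃ k, (k = q ∨ k = σ q) ∧ 19 / 26 ≤ a k q := by
  rcases h.ev q with hq | hq
  · have := h.l11 q hq; have := h.u11 q hq; have := h.l22 q hq; have := h.u22 q hq
    have := h.l12 q; have := h.u12 q; have := h.l21 q; have := h.u21 q
    rcases le_total (w q (σ q) + w (σ q) q) (w q q + w (σ q) (σ q)) with hd | hd
    · exact ⟨q, Or.inl rfl, by linarith [((H q hq).1 hd).1]⟩
    · exact ⟨σ q, Or.inr rfl, by linarith [((H q hq).2 hd).2]⟩
  · have H := H _ hq
    have := h.l11 _ hq; have := h.u11 _ hq; have := h.l22 _ hq; have := h.u22 _ hq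
    have := h.l12 q; have := h.u12 q; have := h.l21 q; have := h.u21 q
    rw [h.inv] at *
    rcases le_total (w (σ q) q + w q (σ q)) (w (σ q) (σ q) + w q q) with hd | hd
    · exact ⟨q, Or.inl rfl, by linarith [(H.1 hd).2]⟩
    · exact ⟨σ q, Or.inr rfl, by linarith [(H.2 hd).1]⟩

lemma LowO.low (h : Good n σ e w) {a : Fin n → Fin n → ℝ} (H : LowO n σ e w a) (q : Fin n) :
    ∃ k, (k = q ∨ k = σ q) ∧ -(3 / 26) ≤ a k q := by
  rcases h.ev q with hq | hq
  · have := h.l11 q hq; have := h.u11 q hq; have := h.l22 q hq; have := h.u22 q hq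
    have := h.l12 q; have := h.u12 q; have := h.l21 q; have := h.u21 q
    rcases le_total (w q (σ q) + w (σ q) q) (w q q + w (σ q) (σ q)) with hd | hd
    · exact ⟨q, Or.inl rfl, by linarith [((H q hq).1 hd).1]⟩
    · exact ⟨σ q, Or.inr rfl, by linarith [((H q hq).2 hd).2]⟩
  · have H := H _ hq
    have := h.l11 _ hq; have := h.u11 _ hq; have := h.l22 _ hq; have := h.u22 _ hq
    have := h.l12 q; have := h.u12 q; have := h.l21 q; have := h.u21 q
    rw [h.inv] at *
    rcases le_total (w (σ q) q + w q (σ q)) (w (σ q) (σ q) + w q q) with hd | hd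
    · exact ⟨q, Or.inl rfl, by linarith [(H.1 hd).2]⟩
    · exact ⟨σ q, Or.inr rfl, by linarith [(H.2 hd).1]⟩

lemma light_step (h : Good n σ e w) (s : BPsys n w A B) (t : ℕ) (α : ℝ)
    (H : ∀ q, ∃ k, (k = q ∨ k = σ q) ∧ α ≤ A t k q) :
    LightLe n σ (B (t + 1)) (1 / 26 - α) := by
  intro i q h1 h2
  obtain ⟨k, hk, hα⟩ := H q
  have hki : k ≠ i := by
    rcases hk with rfl | rfl
    · exact h1
    · rintro rfl; exact h2 (h.inv q).symm
  linarith [s.ble t q i k hki, h.light i q h1 h2]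

/-- Lower bound of a message inside a group. -/
lemma a_step (s : BPsys n w A B) (t : ℕ) (l : ℝ)
    (hl : LightLe n σ (B (t + 1)) l) (x : Fin n) (y y' : Fin n) (hy : ∀ q, q ≠ y → q = y' ∨ (q ≠ x ∧ q ≠ σ x))
    (x' : Fin n) (hx : x' ≠ x) (v : ℝ) (h1 : v ≤ w x y - w x y' + A t x' y') (h2 : v ≤ w x y - l) :
    v ≤ A (t + 2) x y := by
  have := s.age (t + 1) x y (w x y - v) ?_
  · linarith
  · intro q hq
    rcases hy q hq with rfl | ⟨h3, h4⟩
    · linarith [s.ble t q x x' hx]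
    · linarith [hl x q h3 h4]

lemma a_step1 (s : BPsys n w A B) (l : ℝ)
    (hl : LightLe n σ (B 0) l) (x : Fin n) (y y' : Fin n) (hy : ∀ q, q ≠ y → q = y' ∨ (q ≠ x ∧ q ≠ σ x))
    (v : ℝ) (h1 : v ≤ w x y - w x y') (h2 : v ≤ w x y - l) :
    v ≤ A 1 x y := by
  have := s.age 0 x y (w x y - v) ?_
  · linarith
  · intro q hq
    rcases hy q hq with rfl | ⟨h3, h4⟩
    · linarith [s.b0 q x]
    · linarith [hl x q h3 h4]

lemma Good.cov (h : Good n σ e w) (i : Fin n) :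
    (∀ q, q ≠ i → q = σ i ∨ (q ≠ i ∧ q ≠ σ i)) ∧
    (∀ q, q ≠ σ i → q = i ∨ (q ≠ i ∧ q ≠ σ i)) ∧
    (∀ q, q ≠ i → q = σ i ∨ (q ≠ σ i ∧ q ≠ σ (σ i))) ∧
    (∀ q, q ≠ σ i → q = i ∨ (q ≠ σ i ∧ q ≠ σ (σ i))) := by
  simp only [h.inv]
  refine ⟨?_, ?_, ?_, ?_⟩ <;> intro q hq <;> tauto

lemma lowE_step (h : Good n σ e w) (s : BPsys n w A B) (t : ℕ)
    (hl : LightLe n σ (B (t + 1)) (-(18 / 26))) (H : LowE n σ e w (A t)) :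
    LowE n σ e w (A (t + 2)) := by
  intro i hi
  have := h.l11 i hi; have := h.u11 i hi; have := h.l22 i hi; have := h.u22 i hi
  have := h.l12 i; have := h.u12 i; have := h.l21 i; have := h.u21 i
  obtain ⟨c1, c2, c3, c4⟩ := h.cov i
  have hne := h.ne i
  constructor
  · intro hd
    obtain ⟨g1, g2⟩ := (H i hi).1 hd
    exact ⟨a_step s t _ hl i i (σ i) c1 (σ i) hne _ (by linarith) (by linarith),
      a_step s t _ hl (σ i) (σ i) i c4 i hne.symm _ (by linarith) (by linarith)⟩
  · intro hd
    obtain ⟨g1, g2⟩ := (H i hi).2 hd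
    exact ⟨a_step s t _ hl i (σ i) i c2 (σ i) hne _ (by linarith) (by linarith),
      a_step s t _ hl (σ i) i (σ i) c3 i hne.symm _ (by linarith) (by linarith)⟩

lemma lowO_step (h : Good n σ e w) (s : BPsys n w A B) (t : ℕ)
    (hl : LightLe n σ (B (t + 1)) (4 / 26)) (H : LowO n σ e w (A t)) :
    LowO n σ e w (A (t + 2)) := by
  intro i hi
  have := h.l11 i hi; have := h.u11 i hi; have := h.l22 i hi; have := h.u22 i hi
  have := h.l12 i; have := h.u12 i; have := h.l21 i; have := h.u21 i
  obtain ⟨c1, c2, c3, c4⟩ := h.cov i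
  have hne := h.ne i
  constructor
  · intro hd
    obtain ⟨g1, g2⟩ := (H i hi).1 hd
    exact ⟨a_step s t _ hl i i (σ i) c1 (σ i) hne _ (by linarith) (by linarith),
      a_step s t _ hl (σ i) (σ i) i c4 i hne.symm _ (by linarith) (by linarith)⟩
  · intro hd
    obtain ⟨g1, g2⟩ := (H i hi).2 hd
    exact ⟨a_step s t _ hl i (σ i) i c2 (σ i) hne _ (by linarith) (by linarith),
      a_step s t _ hl (σ i) i (σ i) c3 i hne.symm _ (by linarith) (by linarith)⟩

lemma lowE_zero (h : Good n σ e w) (s : BPsys n w A B) : LowE n σ e w (A 0) := by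
  intro i hi
  have := h.l11 i hi; have := h.u11 i hi; have := h.l22 i hi; have := h.u22 i hi
  have := h.l12 i; have := h.u12 i; have := h.l21 i; have := h.u21 i
  simp only [s.a0]
  exact ⟨fun hd => ⟨by linarith, by linarith⟩, fun hd => ⟨by linarith, by linarith⟩⟩

lemma light_zero (h : Good n σ e w) (s : BPsys n w A B) : LightLe n σ (B 0) (4 / 26) := by
  intro i q h1 h2
  rw [s.b0]
  linarith [h.light i q h1 h2]

lemma lowO_one (h : Good n σ e w) (s : BPsys n w A B) : LowO n σ e w (A 1) := by
  intro i hi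
  have := h.l11 i hi; have := h.u11 i hi; have := h.l22 i hi; have := h.u22 i hi
  have := h.l12 i; have := h.u12 i; have := h.l21 i; have := h.u21 i
  obtain ⟨c1, c2, c3, c4⟩ := h.cov i
  have hl := light_zero h s
  constructor
  · intro hd
    exact ⟨a_step1 s _ hl i i (σ i) c1 _ (by linarith) (by linarith),
      a_step1 s _ hl (σ i) (σ i) i c4 _ (by linarith) (by linarith)⟩
  · intro hd
    exact ⟨a_step1 s _ hl i (σ i) i c2 _ (by linarith) (by linarith),
      a_step1 s _ hl (σ i) i (σ i) c3 _ (by linarith) (by linarith)⟩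

lemma all_light (h : Good n σ e w) (s : BPsys n w A B) (m : ℕ) :
    LightLe n σ (B (2 * m)) (4 / 26) ∧ LowE n σ e w (A (2 * m)) ∧
    LightLe n σ (B (2 * m + 1)) (-(18 / 26)) ∧ LowO n σ e w (A (2 * m + 1)) := by
  have key : ∀ t, LowE n σ e w (A t) → LightLe n σ (B (t + 1)) (-(18 / 26)) := by
    intro t ht
    have := light_step h s t _ (fun q => ht.low h q)
    norm_num at this ⊢
    exact this
  have key2 : ∀ t, LowO n σ e w (A t) → LightLe n σ (B (t + 1)) (4 / 26) := by
    intro t ht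
    have := light_step h s t _ (fun q => ht.low h q)
    norm_num at this ⊢
    exact this
  induction m with
  | zero =>
    exact ⟨light_zero h s, lowE_zero h s, key 0 (lowE_zero h s), lowO_one h s⟩
  | succ m ih =>
    obtain ⟨i1, i2, i3, i4⟩ := ih
    have j1 := key2 _ i4
    have j2 := lowE_step h s _ i3 i2
    have j3 := key _ j2
    have j4 := lowO_step h s _ j1 i4
    exact ⟨j1, j2, j3, j4⟩

lemma all_light' (h : Good n σ e w) (s : BPsys n w A B) (m : ℕ) :
    LightLe n σ (A (2 * m + 1)) (-(18 / 26)) :=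
  (all_light h.symm s.symm m).2.2.1

/-- Two exact steps inside a group. -/
lemma exact_step (h : Good n σ e w) (s : BPsys n w A B) (m : ℕ) (x x' y y' : Fin n)
    (hx : x' = σ x) (hy : y' = σ y) (hxy : x = y ∨ x = y') (v : ℝ) (hv : B (2 * m) y' x' = v)
    (h1 : 4 / 26 ≤ v) (h2 : v ≤ w x' y + 18 / 26) :
    B (2 * (m + 1)) y x = w x y - w x' y + v := by
  subst hv
  have hx' : x = σ x' := by rw [hx, h.inv]
  have hy' : y = σ y' := by rw [hy, h.inv]
  have nx : x' ≠ x := by rw [hx]; exact h.ne x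
  have ny : y' ≠ y := by rw [hy]; exact h.ne y
  have hA : A (2 * m + 1) x' y = w x' y - B (2 * m) y' x' := by
    apply le_antisymm
    · exact s.ale _ _ _ _ ny
    · apply s.age
      intro q hq
      by_cases hq' : q = y'
      · rw [hq']
      · refine le_trans ((all_light h s m).1 x' q ?_ ?_) h1
        · rcases hxy with rfl | rfl
          · rwa [hx, ← hy]
          · rwa [hx, ← hy']
        · rcases hxy with rfl | rfl
          · rwa [← hx']
          · rwa [← hx']
  have hB : B (2 * m + 1 + 1) y x = w x y - A (2 * m + 1) x' y := by
    apply le_antisymm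
    · exact s.ble _ _ _ _ nx
    · apply s.bge
      intro q hq
      by_cases hq' : q = x'
      · rw [hq']
      · have := all_light' h s m y q ?_ ?_
        · linarith
        · rcases hxy with rfl | rfl
          · exact hq
          · rw [hy']; rwa [← hx]
        · rcases hxy with rfl | rfl
          · rwa [← hx]
          · rwa [← hy]
  have e2 : 2 * (m + 1) = 2 * m + 1 + 1 := by ring
  rw [e2, hB, hA]; ring

lemma exact_all (h : Good n σ e w) (s : BPsys n w A B) (i : Fin n) (hi : e i) (Δ : ℝ)
    (hΔ : Δ = w i i + w (σ i) (σ i) - w i (σ i) - w (σ i) i) (k : ℕ)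
    (hk : (2 * k + 2) * |Δ| < 1 / 26) :
    (B (2 * (2 * k)) i i = w i i + k * Δ ∧
     B (2 * (2 * k)) (σ i) (σ i) = w (σ i) (σ i) + k * Δ ∧
     B (2 * (2 * k)) i (σ i) = w (σ i) i - k * Δ ∧
     B (2 * (2 * k)) (σ i) i = w i (σ i) - k * Δ) ∧
    (B (2 * (2 * k + 1)) i i = w i i - w (σ i) i + w (σ i) (σ i) + k * Δ ∧
     B (2 * (2 * k + 1)) (σ i) (σ i) = w (σ i) (σ i) - w i (σ i) + w i i + k * Δ ∧
     B (2 * (2 * k + 1)) i (σ i) = w (σ i) i - w i i + w i (σ i) - k * Δ ∧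
     B (2 * (2 * k + 1)) (σ i) i = w i (σ i) - w (σ i) (σ i) + w (σ i) i - k * Δ) := by
  have := h.l11 i hi; have := h.u11 i hi; have := h.l22 i hi; have := h.u22 i hi
  have := h.l12 i; have := h.u12 i; have := h.l21 i; have := h.u21 i
  have hinv := h.inv i
  have step : ∀ k : ℕ, (k:ℝ) * |Δ| < 1 / 26 → (B (2 * (2 * k)) i i = w i i + k * Δ ∧
     B (2 * (2 * k)) (σ i) (σ i) = w (σ i) (σ i) + k * Δ ∧
     B (2 * (2 * k)) i (σ i) = w (σ i) i - k * Δ ∧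
     B (2 * (2 * k)) (σ i) i = w i (σ i) - k * Δ) →
    (B (2 * (2 * k + 1)) i i = w i i - w (σ i) i + w (σ i) (σ i) + k * Δ ∧
     B (2 * (2 * k + 1)) (σ i) (σ i) = w (σ i) (σ i) - w i (σ i) + w i i + k * Δ ∧
     B (2 * (2 * k + 1)) i (σ i) = w (σ i) i - w i i + w i (σ i) - k * Δ ∧
     B (2 * (2 * k + 1)) (σ i) i = w i (σ i) - w (σ i) (σ i) + w (σ i) i - k * Δ) := by
    intro k hk ⟨h1, h2, h3, h4⟩
    have hab : |(k:ℝ) * Δ| < 1 / 26 := by rwa [abs_mul, Nat.abs_cast]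
    obtain ⟨u1, u2⟩ := abs_lt.mp hab
    refine ⟨?_, ?_, ?_, ?_⟩
    · rw [exact_step h s (2 * k) i (σ i) i (σ i) rfl rfl (Or.inl rfl) _ h2 (by linarith)
        (by linarith)]; ring
    · rw [exact_step h s (2 * k) (σ i) i (σ i) i hinv.symm hinv.symm (Or.inl rfl) _ h1
        (by linarith) (by linarith)]; ring
    · rw [exact_step h s (2 * k) (σ i) i i (σ i) hinv.symm rfl (Or.inr rfl) _ h4
        (by linarith) (by linarith)]; ring
    · rw [exact_step h s (2 * k) i (σ i) (σ i) i rfl hinv.symm (Or.inr rfl) _ h3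
        (by linarith) (by linarith)]; ring
  have hpos : 0 ≤ |Δ| := abs_nonneg _
  have first : (B (2 * (2 * k)) i i = w i i + k * Δ ∧
     B (2 * (2 * k)) (σ i) (σ i) = w (σ i) (σ i) + k * Δ ∧
     B (2 * (2 * k)) i (σ i) = w (σ i) i - k * Δ ∧
     B (2 * (2 * k)) (σ i) i = w i (σ i) - k * Δ) := by
    induction k with
    | zero => simp [s.b0]
    | succ k ih =>
      have hk0 : 0 ≤ (k : ℝ) * |Δ| := by positivity
      push_cast at hk
      have ih := ih (by linarith)
      obtain ⟨h1, h2, h3, h4⟩ := step k (by linarith) ih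
      have hab : |(k:ℝ) * Δ| < 1 / 26 := by rw [abs_mul, Nat.abs_cast]; linarith
      have hD : |Δ| < 1 / 26 := by linarith
      obtain ⟨u1, u2⟩ := abs_lt.mp hab
      obtain ⟨v1, v2⟩ := abs_lt.mp hD
      have e3 : 2 * (2 * (k + 1)) = 2 * (2 * k + 1 + 1) := by ring
      rw [e3]
      push_cast
      refine ⟨?_, ?_, ?_, ?_⟩
      · rw [exact_step h s (2 * k + 1) i (σ i) i (σ i) rfl rfl (Or.inl rfl) _ h2 (by linarith)
          (by linarith), hΔ]; ring
      · rw [exact_step h s (2 * k + 1) (σ i) i (σ i) i hinv.symm hinv.symm (Or.inl rfl) _ h1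
          (by linarith) (by linarith), hΔ]; ring
      · rw [exact_step h s (2 * k + 1) (σ i) i i (σ i) hinv.symm rfl (Or.inr rfl) _ h4
          (by linarith) (by linarith), hΔ]; ring
      · rw [exact_step h s (2 * k + 1) i (σ i) (σ i) i rfl hinv.symm (Or.inr rfl) _ h3
          (by linarith) (by linarith), hΔ]; ring
  have hk0 : 0 ≤ (k : ℝ) * |Δ| := by positivity
  exact ⟨first, step k (by linarith) first⟩

end det

/-- The deterministic core: a group with small gap prevents convergence. -/
lemma not_converged (n : ℕ) (hn : 2 ≤ n) (σ : Fin n → Fin n) (e : Fin n → Prop)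
    (w : Fin n → Fin n → ℝ) (h : Good n σ e w) (i : Fin n) (hi : e i) (t : ℕ)
    (hk : (2 * t + 2) * |w i i + w (σ i) (σ i) - w i (σ i) - w (σ i) i| < 1 / 26) :
    ¬ BPConvergedBy n w (t - 1) := by
  rintro ⟨M, hM, -, hc⟩
  have s := BPsys_YAB n hn w
  obtain ⟨⟨p1, p2, p3, p4⟩, ⟨q1, q2, q3, q4⟩⟩ := exact_all h s i hi _ rfl t hk
  obtain ⟨j, hj, hj'⟩ := hc (2 * (2 * t)) (by omega) i
  obtain ⟨j2, hj2, hj2'⟩ := hc (2 * (2 * t + 1)) (by omega) i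
  have hjj : j = j2 := by
    by_contra hne
    exact (hM _ hj _ hj2 (by simpa using hne)).1 rfl
  subst hjj
  simp only [belief_lt_iff n hn] at hj' hj2'
  have := h.l11 i hi; have := h.u11 i hi; have := h.l22 i hi; have := h.u22 i hi
  have := h.l12 i; have := h.u12 i; have := h.l21 i; have := h.u21 i
  set Δ := w i i + w (σ i) (σ i) - w i (σ i) - w (σ i) i with hΔ
  have hab : |(2 * (t:ℝ) + 2) * Δ| < 1 / 26 := by
    rwa [abs_mul, abs_of_nonneg (by positivity : (0:ℝ) ≤ 2 * (t:ℝ) + 2)]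
  have hab2 : |(2 * (t:ℝ)) * Δ| < 1 / 26 := by
    rw [abs_mul, abs_of_nonneg (by positivity : (0:ℝ) ≤ 2 * (t:ℝ))]
    linarith [abs_nonneg Δ]
  obtain ⟨u1, u2⟩ := abs_lt.mp hab
  obtain ⟨v1, v2⟩ := abs_lt.mp hab2
  by_cases h1 : j = i
  · have := hj2' (σ i) (by rw [h1]; exact h.ne i)
    rw [h1] at this
    linarith
  · by_cases h2 : j = σ i
    · have := hj' i (Ne.symm h1)
      rw [h2] at this
      linarith
    · have := hj' i (Ne.symm h1)
      have := (all_light h s (2 * t)).1 i j h1 h2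
      linarith

lemma unifIoc_eq (a b : ℝ) : unifIoc a b = unifIcc a b := by
  unfold unifIoc unifIcc
  rw [Measure.restrict_congr_set Ioc_ae_eq_Icc]

lemma unifIcc_apply (a b : ℝ) (s : Set ℝ) (hs : MeasurableSet s) :
    unifIcc a b s = (ENNReal.ofReal (b - a))⁻¹ * volume (s ∩ Set.Icc a b) := by
  simp [unifIcc, Measure.restrict_apply hs]

lemma unifIcc_prob (a b : ℝ) (h : a < b) : IsProbabilityMeasure (unifIcc a b) := by
  constructor
  rw [unifIcc_apply _ _ _ MeasurableSet.univ, Set.univ_inter, Real.volume_Icc]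
  apply ENNReal.inv_mul_cancel
  · simpa using h
  · exact ENNReal.ofReal_ne_top

lemma unifIcc_ae (a b : ℝ) : ∀ᵐ x ∂(unifIcc a b), x ∈ Set.Icc a b := by
  rw [ae_iff]
  have : {x | x ∉ Set.Icc a b} = (Set.Icc a b)ᶜ := rfl
  rw [this, unifIcc_apply _ _ _ measurableSet_Icc.compl]
  simp

lemma unifIcc_le (a b φ : ℝ) (hφ : 0 < φ) (h : 1 / φ ≤ b - a) (s : Set ℝ) :
    unifIcc a b s ≤ ENNReal.ofReal φ * volume s := by
  simp only [unifIcc, Measure.smul_apply, smul_eq_mul]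
  gcongr
  · rw [← ENNReal.ofReal_inv_of_pos (lt_of_lt_of_le (by positivity) h)]
    apply ENNReal.ofReal_le_ofReal
    rw [inv_le_comm₀ (lt_of_lt_of_le (by positivity) h) hφ]
    simpa using h
  · exact Measure.restrict_le_self

lemma unifIcc_Icc_compl (a b φ c ε : ℝ) (hφ : 0 < φ) (h : b - a = 4 / φ) (hε : 0 ≤ ε)
    (hc : a ≤ c - ε) (hc' : c ≤ b) :
    unifIcc a b (Set.Icc (c - ε) c)ᶜ = ENNReal.ofReal (1 - ε * φ / 4) := by
  have hab : a < b := by have : 0 < 4 / φ := by positivity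
                         linarith
  have := unifIcc_prob a b hab
  rw [prob_compl_eq_one_sub measurableSet_Icc, unifIcc_apply _ _ _ measurableSet_Icc,
    Set.inter_eq_left.mpr (Set.Icc_subset_Icc hc hc'), Real.volume_Icc, h,
    ← ENNReal.ofReal_inv_of_pos (by positivity), ← ENNReal.ofReal_mul (by positivity),
    ← ENNReal.ofReal_one, ← ENNReal.ofReal_sub _ (by
      apply mul_nonneg; positivity; linarith)]
  congr 1
  field_simp
  ring

/-- Left end of the support. -/
noncomputable def wlo (n : ℕ) (φ : ℝ) (p : Fin n × Fin n) : ℝ :=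
  if p.1.val / 2 = p.2.val / 2 then
    if p.1.val % 2 = 0 then
      if p.2.val % 2 = 0 then 1 - 1 / φ else 23 / 26
    else
      if p.2.val % 2 = 0 then 23 / 26 else 20 / 26 - 1 / φ
  else 0

/-- Right end of the support. -/
noncomputable def whi (n : ℕ) (φ : ℝ) (p : Fin n × Fin n) : ℝ :=
  if p.1.val / 2 = p.2.val / 2 then
    if p.1.val % 2 = 0 then
      if p.2.val % 2 = 0 then 1 else 23 / 26 + 1 / φ
    else
      if p.2.val % 2 = 0 then 23 / 26 + 1 / φ else 20 / 26 + 3 / φ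
  else 1 / φ

lemma smoothed_eq (n : ℕ) (φ : ℝ) (p : Fin n × Fin n) :
    smoothedMarginal n φ p = unifIcc (wlo n φ p) (whi n φ p) := by
  unfold smoothedMarginal wlo whi
  split_ifs <;> simp only [unifIoc_eq]

lemma inv_bd {φ : ℝ} (hφ : 26 ≤ φ) : 0 < 1 / φ ∧ 1 / φ ≤ 1 / 26 :=
  ⟨by positivity, one_div_le_one_div_of_le (by norm_num) hφ⟩

lemma three_div (φ : ℝ) : 3 / φ = 3 * (1 / φ) := by ring

lemma four_div (φ : ℝ) : 4 / φ = 4 * (1 / φ) := by ring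

lemma wlen (n : ℕ) (φ : ℝ) (hφ : 26 ≤ φ) (p : Fin n × Fin n) :
    1 / φ ≤ whi n φ p - wlo n φ p := by
  obtain ⟨h1, h2⟩ := inv_bd hφ
  unfold wlo whi
  rw [three_div]
  split_ifs <;> linarith

lemma wlo_nonneg (n : ℕ) (φ : ℝ) (hφ : 26 ≤ φ) (p : Fin n × Fin n) : 0 ≤ wlo n φ p := by
  obtain ⟨h1, h2⟩ := inv_bd hφ
  unfold wlo
  split_ifs <;> linarith

lemma whi_le_one (n : ℕ) (φ : ℝ) (hφ : 26 ≤ φ) (p : Fin n × Fin n) : whi n φ p ≤ 1 := by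
  obtain ⟨h1, h2⟩ := inv_bd hφ
  unfold whi
  rw [three_div]
  split_ifs <;> linarith

lemma smoothed_prob (n : ℕ) (φ : ℝ) (hφ : 26 ≤ φ) (p : Fin n × Fin n) :
    IsProbabilityMeasure (smoothedMarginal n φ p) := by
  rw [smoothed_eq]
  exact unifIcc_prob _ _ (by linarith [wlen n φ hφ p, (inv_bd hφ).1])

/-- The partner inside the group. -/
def sig (n : ℕ) (i : Fin n) : Fin n :=
  if i.val % 2 = 0 then (if h : i.val + 1 < n then ⟨i.val + 1, h⟩ else i)
  else ⟨i.val - 1, by omega⟩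

lemma sig_even (n : ℕ) (hn : Even n) (i : Fin n) (h : i.val % 2 = 0) :
    (sig n i).val = i.val + 1 := by
  obtain ⟨m, rfl⟩ := hn
  have := i.isLt
  unfold sig
  rw [if_pos h, dif_pos (by omega)]

lemma sig_odd (n : ℕ) (i : Fin n) (h : ¬ i.val % 2 = 0) :
    (sig n i).val = i.val - 1 := by
  unfold sig
  rw [if_neg h]

lemma good_of_box (n : ℕ) (φ : ℝ) (hφ : 26 ≤ φ) (hn : Even n) (w : Fin n × Fin n → ℝ)
    (hw : ∀ p, w p ∈ Set.Icc (wlo n φ p) (whi n φ p)) :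
    Good n (sig n) (fun i => i.val % 2 = 0) (fun i j => w (i, j)) := by
  obtain ⟨h1, h2⟩ := inv_bd hφ
  have key : ∀ i : Fin n, (i.val % 2 = 0 ∧ (sig n i).val = i.val + 1) ∨
      (i.val % 2 = 1 ∧ (sig n i).val = i.val - 1) := by
    intro i
    by_cases h : i.val % 2 = 0
    · exact Or.inl ⟨h, sig_even n hn i h⟩
    · exact Or.inr ⟨by omega, sig_odd n i h⟩
  refine ⟨?_, ?_, ?_, ?_, ?_, ?_, ?_, ?_, ?_, ?_⟩
  · intro i
    apply Fin.ext
    have := key i; have := key (sig n i)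
    omega
  · intro i h
    have h := congrArg Fin.val h
    have := key i
    omega
  · intro i
    have := key i; have := key (sig n i)
    omega
  · intro i hi
    have := (hw (i, i)).1
    simp only [wlo, hi, if_true] at this
    linarith
  · intro i hi
    have := (hw (i, i)).2
    simp only [whi, hi, if_true] at this
    linarith
  · intro i hi
    have := (hw (sig n i, sig n i)).1
    have hs : ¬ (sig n i).val % 2 = 0 := by have := key i; omega
    simp only [wlo, hs, if_true, if_false] at this
    linarith
  · intro i hi
    have := (hw (sig n i, sig n i)).2
    have hs : ¬ (sig n i).val % 2 = 0 := by have := key i; omega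
    simp only [whi, hs, if_true, if_false] at this
    rw [three_div] at this
    linarith
  · intro i
    have := (hw (i, sig n i)).1
    have h3 := key i
    have hs : i.val / 2 = (sig n i).val / 2 := by omega
    simp only [wlo] at this
    rw [if_pos hs] at this
    split_ifs at this <;> first | linarith | omega
  · intro i
    have := (hw (i, sig n i)).2
    have h3 := key i
    have hs : i.val / 2 = (sig n i).val / 2 := by omega
    simp only [whi] at this
    rw [if_pos hs] at this
    split_ifs at this <;> first | linarith | omega
  · intro i j h3 h4
    have := (hw (i, j)).2
    have h5 := key i
    have hs : ¬ i.val / 2 = j.val / 2 := by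
      intro h
      have h3' : j.val ≠ i.val := fun h => h3 (Fin.ext h)
      have h4' : j.val ≠ (sig n i).val := fun h => h4 (Fin.ext h)
      omega
    simp only [whi] at this
    rw [if_neg hs] at this
    linarith

lemma pi_box {ι : Type*} [Fintype ι] (μ : ι → Measure ℝ) [∀ i, IsProbabilityMeasure (μ i)]
    (s : ι → Set ℝ) (h : ∀ i, ∀ᵐ x ∂(μ i), x ∈ s i) :
    ∀ᵐ w ∂(Measure.pi μ), ∀ i, w i ∈ s i := by
  rw [ae_all_iff]
  intro i
  exact (Measure.tendsto_eval_ae_ae (μ := μ) (i := i)).eventually (h i)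

/-- The target value of the light diagonal weight. -/
def target (n : ℕ) (w : Fin n × Fin n → ℝ) (i : Fin n) : ℝ :=
  w (sig n i, i) + w (i, sig n i) - w (sig n i, sig n i)

/-- The event that no group has a small gap. -/
def badSet (n : ℕ) (ε : ℝ) : Set (Fin n × Fin n → ℝ) :=
  {w | ∀ p : Fin n × Fin n, (p.1 = p.2 ∧ p.1.val % 2 = 1) →
    w p ∈ (Set.Icc (target n w p.1 - ε) (target n w p.1))ᶜ}

lemma measurable_badSet (n : ℕ) (ε : ℝ) : MeasurableSet (badSet n ε) := by
  have : badSet n ε = ⋂ p : Fin n × Fin n, ⋂ _ : (p.1 = p.2 ∧ p.1.val % 2 = 1),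
      ({w | target n w p.1 - ε ≤ w p} ∩ {w | w p ≤ target n w p.1})ᶜ := by
    ext w
    simp [badSet]
  rw [this]
  have hm : ∀ i, Measurable fun w => target n w i := by
    intro i; unfold target; fun_prop
  refine MeasurableSet.iInter fun p => MeasurableSet.iInter fun _ => ?_
  refine MeasurableSet.compl (MeasurableSet.inter ?_ ?_)
  · exact measurableSet_le ((hm _).sub_const _) (by fun_prop)
  · exact measurableSet_le (by fun_prop) (hm _)

lemma card_S (n : ℕ) : n / 2 ≤ Fintype.card {p : Fin n × Fin n // p.1 = p.2 ∧ p.1.val % 2 = 1} := by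
  have := Fintype.card_le_of_injective (α := Fin (n / 2))
    (β := {p : Fin n × Fin n // p.1 = p.2 ∧ p.1.val % 2 = 1})
    (fun k => ⟨(⟨2 * k.val + 1, by omega⟩, ⟨2 * k.val + 1, by omega⟩), rfl, by
      show (2 * k.val + 1) % 2 = 1
      omega⟩) (by
      intro a b hab
      have h := congrArg (fun x => x.1.1.val) hab
      apply Fin.ext
      simp at h
      omega)
  simpa using this

lemma bad_le (n : ℕ) (φ ε : ℝ) (hφ : 26 ≤ φ) (hε : 0 ≤ ε) (hε' : ε ≤ 1 / φ) :
    Measure.pi (smoothedMarginal n φ) (badSet n ε)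
      ≤ ENNReal.ofReal ((1 - ε * φ / 4) ^ (n / 2)) := by
  obtain ⟨h1, h2⟩ := inv_bd hφ
  have := smoothed_prob n φ hφ
  set S : Fin n × Fin n → Prop := fun p => p.1 = p.2 ∧ p.1.val % 2 = 1 with hS
  have mp := measurePreserving_piEquivPiSubtypeProd (smoothedMarginal n φ) S
  have mp' := mp.symm
  rw [← mp'.measure_preimage (measurable_badSet n ε).nullMeasurableSet,
    Measure.prod_apply_symm (mp'.measurable (measurable_badSet n ε))]
  have hεφ : ε * φ / 4 ≤ 1 := by
    have : ε * φ ≤ 1 := by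
      calc ε * φ ≤ 1 / φ * φ := by gcongr
        _ = 1 := by field_simp
    linarith
  have hεφ0 : 0 ≤ ε * φ / 4 := by positivity
  have hbox : ∀ᵐ z ∂(Measure.pi fun p : {p // ¬ S p} => smoothedMarginal n φ p),
      ∀ p : {p // ¬ S p}, z p ∈ Set.Icc (wlo n φ p) (whi n φ p) := by
    apply pi_box _ (fun p : {p // ¬ S p} => Set.Icc (wlo n φ p) (whi n φ p))
    intro p
    rw [smoothed_eq]
    exact unifIcc_ae _ _
  refine le_trans (lintegral_mono_ae (g := fun _ => ENNReal.ofReal ((1 - ε * φ / 4) ^ (n / 2)))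
    (hbox.mono ?_)) (by simp)
  intro z hz
  have hsymm : ∀ (x : {p // S p} → ℝ) (p : Fin n × Fin n),
      (MeasurableEquiv.piEquivPiSubtypeProd (fun _ => ℝ) S).symm (x, z) p
        = if h : S p then x ⟨p, h⟩ else z ⟨p, h⟩ := fun x p => rfl
  have hnS : ∀ i : Fin n, i.val % 2 = 1 → (sig n i).val = i.val - 1 ∧ ¬ S (sig n i, i) ∧
      ¬ S (i, sig n i) ∧ ¬ S (sig n i, sig n i) := by
    intro i hi
    have h3 := sig_odd n i (by omega)
    refine ⟨h3, ?_, ?_, ?_⟩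
    · rintro ⟨h4, -⟩
      have h4 := congrArg Fin.val h4
      simp only at h4
      omega
    · rintro ⟨h4, -⟩
      have h4 := congrArg Fin.val h4
      simp only at h4
      omega
    · rintro ⟨-, h4⟩
      simp only at h4
      omega
  have htar : ∀ (x : {p // S p} → ℝ) (i : Fin n) (hi : i.val % 2 = 1),
      target n ((MeasurableEquiv.piEquivPiSubtypeProd (fun _ => ℝ) S).symm (x, z)) i =
        z ⟨(sig n i, i), (hnS i hi).2.1⟩ + z ⟨(i, sig n i), (hnS i hi).2.2.1⟩
          - z ⟨(sig n i, sig n i), (hnS i hi).2.2.2⟩ := by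
    intro x i hi
    unfold target
    rw [hsymm, hsymm, hsymm, dif_neg (hnS i hi).2.1, dif_neg (hnS i hi).2.2.1,
      dif_neg (hnS i hi).2.2.2]
  let T : Fin n → ℝ := fun i =>
    target n ((MeasurableEquiv.piEquivPiSubtypeProd (fun _ => ℝ) S).symm (fun _ => 0, z)) i
  have hsub : (fun x => (x, z)) ⁻¹' ((MeasurableEquiv.piEquivPiSubtypeProd (fun _ => ℝ) S).symm ⁻¹'
      (badSet n ε)) ⊆ Set.pi Set.univ
        (fun p : {p // S p} => (Set.Icc (T p.1.1 - ε) (T p.1.1))ᶜ) := by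
    intro x hx p _
    have hp := hx p.1 p.2
    rw [htar x p.1.1 p.2.2, hsymm, dif_pos p.2] at hp
    show x p ∈ (Set.Icc (target n _ p.1.1 - ε) (target n _ p.1.1))ᶜ
    rw [htar _ p.1.1 p.2.2]
    exact hp
  refine le_trans (measure_mono hsub) ?_
  rw [Measure.pi_pi]
  have hval : ∀ p : {p // S p}, smoothedMarginal n φ p (Set.Icc (T p.1.1 - ε) (T p.1.1))ᶜ
      = ENNReal.ofReal (1 - ε * φ / 4) := by
    rintro ⟨⟨i, j⟩, hp1, hp2⟩
    simp only at hp1 hp2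
    subst hp1
    have hT : T i = _ := htar (fun _ => 0) i hp2
    obtain ⟨a1, a2⟩ := hz ⟨(sig n i, i), (hnS i hp2).2.1⟩
    obtain ⟨b1, b2⟩ := hz ⟨(i, sig n i), (hnS i hp2).2.2.1⟩
    obtain ⟨c1, c2⟩ := hz ⟨(sig n i, sig n i), (hnS i hp2).2.2.2⟩
    have g1 := (hnS i hp2).1
    have g2 : (sig n i).val / 2 = i.val / 2 := by omega
    have g3 : (sig n i).val % 2 = 0 := by omega
    have g4 : ¬ i.val % 2 = 0 := by omega
    simp only [wlo, whi, g2, g3, g4, if_true, if_false] at a1 a2 b1 b2 c1 c2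
    have e1 : wlo n φ (i, i) = 20 / 26 - 1 / φ := by simp only [wlo, g4, if_true, if_false]
    have e2 : whi n φ (i, i) = 20 / 26 + 3 / φ := by simp only [whi, g4, if_true, if_false]
    show smoothedMarginal n φ (i, i) (Set.Icc (T i - ε) (T i))ᶜ = _
    rw [smoothed_eq, e1, e2]
    apply unifIcc_Icc_compl _ _ _ _ _ (by linarith) _ hε
    · rw [hT]; linarith
    · rw [hT, three_div]; linarith
    · rw [three_div, four_div]; ring
  simp only [hval, Finset.prod_const, Finset.card_univ]
  rw [ENNReal.ofReal_pow (by linarith)]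
  apply pow_le_pow_right_of_le_one'
  · rw [← ENNReal.ofReal_one]
    exact ENNReal.ofReal_le_ofReal (by linarith)
  · exact card_S n

lemma real_bd (p : ℝ) (N : ℕ) (hp : 0 ≤ p) (hNp : N * p ≤ 1) (hp1 : p ≤ 1) :
    (1 - p) ^ N ≤ 1 - N * p / 2 := by
  have h1 : (1 - p) ^ N * (1 + N * p) ≤ 1 := by
    have hb := one_add_mul_le_pow (a := p) (by linarith) N
    calc (1 - p) ^ N * (1 + N * p) ≤ (1 - p) ^ N * (1 + p) ^ N := by
          have : 0 ≤ (1 - p) ^ N := pow_nonneg (by linarith) _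
          gcongr
      _ = (1 - p ^ 2) ^ N := by rw [← mul_pow]; ring
      _ ≤ 1 := pow_le_one₀ (by nlinarith) (by nlinarith)
  have h0 : 0 ≤ N * p := by positivity
  set x := N * p
  have h2 : 1 ≤ (1 - x / 2) * (1 + x) := by nlinarith
  exact le_of_mul_le_mul_right (h1.trans h2) (by linarith)

/-- **Smoothed lower tail bound on `K_{n,n}`.** For `φ ≥ 26` and even `n ≥ 2`, the
smoothed weight distributions above are probability distributions on `[0,1]` with
densities bounded by `φ`, and there are constants `c > 0` and `C > 0` such that for
every `t ≥ nφ/c` the probability that BP on `K_{n,n}` needs at least `t` iterations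
to converge (i.e. has not converged by iteration `t - 1`) is at least `C·n·φ/t`. -/
theorem bp_Knn_smoothed_lower_tail :
    ∃ c C : ℝ, 0 < c ∧ 0 < C ∧
      ∀ (φ : ℝ) (n : ℕ), 26 ≤ φ → 2 ≤ n → Even n →
        (∀ p : Fin n × Fin n, IsProbabilityMeasure (smoothedMarginal n φ p)) ∧
        (∀ p : Fin n × Fin n, smoothedMarginal n φ p (Set.Icc (0 : ℝ) 1)ᶜ = 0) ∧
        (∀ (p : Fin n × Fin n) (s : Set ℝ),
          smoothedMarginal n φ p s ≤ ENNReal.ofReal φ * volume s) ∧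
        ∀ t : ℕ, (n : ℝ) * φ / c ≤ t →
          ENNReal.ofReal (C * n * φ / t) ≤
            Measure.pi (smoothedMarginal n φ)
              {w : Fin n × Fin n → ℝ | ¬ BPConvergedBy n (fun i j => w (i, j)) (t - 1)} := by
  refine ⟨1, 1 / 3200, one_pos, by norm_num, ?_⟩
  intro φ n hφ hn hev
  obtain ⟨h1, h2⟩ := inv_bd hφ
  have hφ0 : 0 < φ := by linarith
  have hprob := smoothed_prob n φ hφ
  refine ⟨hprob, ?_, ?_, ?_⟩
  · intro p
    rw [smoothed_eq]
    have := unifIcc_ae (wlo n φ p) (whi n φ p)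
    refine measure_mono_null ?_ (ae_iff.mp this)
    intro x hx hx'
    exact hx ⟨(wlo_nonneg n φ hφ p).trans hx'.1, hx'.2.trans (whi_le_one n φ hφ p)⟩
  · intro p s
    rw [smoothed_eq]
    exact unifIcc_le _ _ _ hφ0 (wlen n φ hφ p) s
  · intro t ht
    rw [div_one] at ht
    have hn2 : (2 : ℝ) ≤ n := by exact_mod_cast hn
    have hnφ : φ ≤ n * φ := by nlinarith
    have htφ : φ ≤ t := hnφ.trans ht
    have ht0 : (0 : ℝ) < t := by linarith
    set ε : ℝ := 1 / (200 * t) with hε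
    have hε0 : 0 < ε := by positivity
    have hεφ : ε ≤ 1 / φ := by
      apply one_div_le_one_div_of_le hφ0
      linarith
    have hbox : ∀ᵐ w ∂(Measure.pi (smoothedMarginal n φ)),
        ∀ p, w p ∈ Set.Icc (wlo n φ p) (whi n φ p) := by
      apply pi_box _ (fun p => Set.Icc (wlo n φ p) (whi n φ p))
      intro p
      rw [smoothed_eq]
      exact unifIcc_ae _ _
    have hmono : Measure.pi (smoothedMarginal n φ) (badSet n ε)ᶜ ≤
        Measure.pi (smoothedMarginal n φ)
          {w : Fin n × Fin n → ℝ | ¬ BPConvergedBy n (fun i j => w (i, j)) (t - 1)} := by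
      apply measure_mono_ae
      filter_upwards [hbox] with w hw hbad
      have hg := good_of_box n φ hφ hev w hw
      have hbad : w ∉ badSet n ε := hbad
      simp only [badSet, Set.mem_ofPred_eq, not_forall, Set.mem_compl_iff, not_not] at hbad
      obtain ⟨⟨i, j⟩, ⟨hij, hi⟩, hm⟩ := hbad
      simp only at hij hi hm
      subst hij
      obtain ⟨m1, m2⟩ := hm
      have he : (sig n i).val % 2 = 0 := by
        have := sig_odd n i (by omega)
        omega
      refine not_converged n hn (sig n) _ _ hg (sig n i) he t ?_
      have hinv := hg.inv i
      simp only [hinv]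
      unfold target at m1 m2
      have habs : |w (sig n i, sig n i) + w (i, i) - w (sig n i, i) - w (i, sig n i)| ≤ ε := by
        rw [abs_le]
        constructor <;> linarith
      have ht1 : (1 : ℝ) ≤ t := by linarith
      calc (2 * (t : ℝ) + 2) * _ ≤ (4 * t) * ε := by
            apply mul_le_mul _ habs (abs_nonneg _) (by positivity)
            linarith
        _ = 4 / 200 := by rw [hε]; field_simp
        _ < 1 / 26 := by norm_num
    refine le_trans ?_ hmono
    rw [prob_compl_eq_one_sub (measurable_badSet n ε)]
    have hb := bad_le n φ ε hφ hε0.le hεφ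
    have hN : ((n / 2 : ℕ) : ℝ) = n / 2 := by
      obtain ⟨m, rfl⟩ := hev
      rw [← two_mul, Nat.mul_div_cancel_left _ two_pos]
      push_cast; ring
    have hp : ε * φ / 4 = φ / (800 * t) := by
      rw [hε]; field_simp; norm_num
    have hNp : (n / 2 : ℝ) * (φ / (800 * t)) = n * φ / (1600 * t) := by
      field_simp; norm_num
    have hr := real_bd (ε * φ / 4) (n / 2) (by positivity) (by
        rw [hN, hp, hNp, div_le_one (by positivity)]; linarith) (by
        rw [hp, div_le_one (by positivity)]; linarith)
    rw [hN, hp, hNp] at hr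
    rw [hp] at hb
    have hfin : ENNReal.ofReal (1 / 3200 * n * φ / t) =
        1 - ENNReal.ofReal (1 - n * φ / (1600 * t) / 2) := by
      rw [← ENNReal.ofReal_one, ← ENNReal.ofReal_sub _ (by
        have : n * φ / (1600 * t) ≤ 1 := by
          rw [div_le_one (by positivity)]; linarith
        linarith)]
      congr 1
      field_simp
      ring
    rw [hfin]
    exact tsub_le_tsub_left (hb.trans (ENNReal.ofReal_le_ofReal hr)) _
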